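/- Let v ∈ ℝⁿ be a unit vector such that x_z(0,z̄)v = 0. Then the map g_v(θ) := g(z̄+θv, z̄) is three times differentiable at θ = 0 and its third derivative is given by g_v'''(0) = −( p_z(0,z̄) v ) · ( x_{zz}(0,z̄)(v,v) ), where p_z(0,z̄) is the z-Jacobian of z ↦ p(0,z) and x_{zz}(0,z̄)(v,v) is the second z-derivative of z ↦ x(0,z) evaluated on (v,v). -/

import Mathlib

open scoped InnerProductSpace

noncomputable section

abbrev E (k : ℕ) : Type := EuclideanSpace ℝ (Fin k)

open Set Filter Topology





lemma aux_partial {F : Type*} [NormedAddCommGroup F] [NormedSpace ℝ F] {T r : ℝ} (hT : 0 < T)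
    (k : ℕ) (G : ℝ × ℝ → F) (h : ContDiffOn ℝ (k + 1) G (Icc 0 T ×ˢ Ioo (-r) r)) :
    ∃ G1 : ℝ × ℝ → F, ContDiffOn ℝ k G1 (Icc 0 T ×ˢ Ioo (-r) r) ∧
      ∀ t ∈ Icc 0 T, ∀ θ ∈ Ioo (-r) r, HasDerivAt (fun s => G (t, s)) (G1 (t, θ)) θ := by
  have hu : UniqueDiffOn ℝ (Icc 0 T ×ˢ Ioo (-r) r) :=
    (uniqueDiffOn_Icc hT).prod isOpen_Ioo.uniqueDiffOn
  refine ⟨fun q => fderivWithin ℝ G (Icc 0 T ×ˢ Ioo (-r) r) q (0, 1), ?_, ?_⟩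
  · exact (h.fderivWithin hu (le_refl _)).clm_apply contDiffOn_const
  · intro t ht θ hθ
    have hd : DifferentiableWithinAt ℝ G (Icc 0 T ×ˢ Ioo (-r) r) (t, θ) :=
      (h.differentiableOn (by simp)) (t, θ) ⟨ht, hθ⟩
    have h1 : HasDerivWithinAt (fun s : ℝ => (t, s)) ((0 : ℝ), (1 : ℝ)) (Ioo (-r) r) θ :=
      ((hasDerivAt_const θ t).prodMk (hasDerivAt_id θ)).hasDerivWithinAt
    have := hd.hasFDerivWithinAt.comp_hasDerivWithinAt θ h1 (fun s hs => ⟨ht, hs⟩)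
    exact this.hasDerivAt (isOpen_Ioo.mem_nhds hθ)

lemma aux_slice_cont {F : Type*} [TopologicalSpace F] {T r : ℝ} {G : ℝ × ℝ → F}
    (h : ContinuousOn G (Icc 0 T ×ˢ Ioo (-r) r)) {θ : ℝ} (hθ : θ ∈ Ioo (-r) r) :
    ContinuousOn (fun t => G (t, θ)) (Icc 0 T) :=
  h.comp (by fun_prop) (fun t ht => ⟨ht, hθ⟩)

lemma aux_bound {F : Type*} [NormedAddCommGroup F] {T r : ℝ} {G : ℝ × ℝ → F}
    (h : ContinuousOn G (Icc 0 T ×ˢ Ioo (-r) r)) {a b : ℝ} (ha : -r < a) (hb : b < r) :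
    ∃ C, 0 ≤ C ∧ ∀ t ∈ Icc 0 T, ∀ θ ∈ Icc a b, ‖G (t, θ)‖ ≤ C := by
  obtain ⟨C, hC⟩ := (isCompact_Icc.prod isCompact_Icc : IsCompact (Icc 0 T ×ˢ Icc a b)).exists_bound_of_continuousOn
    (h.mono (prod_mono_right (Icc_subset_Ioo ha hb)))
  exact ⟨max C 0, le_max_right _ _, fun t ht θ hθ => (hC _ ⟨ht, hθ⟩).trans (le_max_left _ _)⟩

lemma aux_integral {T r : ℝ} (hT : 0 < T) {G G1 : ℝ × ℝ → ℝ}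
    (h : ContinuousOn G (Icc 0 T ×ˢ Ioo (-r) r)) (h1 : ContinuousOn G1 (Icc 0 T ×ˢ Ioo (-r) r))
    (hd : ∀ t ∈ Icc 0 T, ∀ θ ∈ Ioo (-r) r, HasDerivAt (fun s => G (t, s)) (G1 (t, θ)) θ)
    {θ : ℝ} (hθ : θ ∈ Ioo (-r) r) :
    HasDerivAt (fun θ => ∫ t in (0 : ℝ)..T, G (t, θ)) (∫ t in (0 : ℝ)..T, G1 (t, θ)) θ := by
  obtain ⟨a, ha1, ha2⟩ := exists_between hθ.1
  obtain ⟨b, hb1, hb2⟩ := exists_between hθ.2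
  obtain ⟨C, -, hC⟩ := aux_bound h1 ha1 hb2
  have hI : Set.uIoc (0 : ℝ) T ⊆ Icc 0 T := by rw [uIoc_of_le hT.le]; exact Ioc_subset_Icc_self
  have hm : ∀ G : ℝ × ℝ → ℝ, ContinuousOn G (Icc 0 T ×ˢ Ioo (-r) r) → ∀ θ ∈ Ioo (-r) r,
      MeasureTheory.AEStronglyMeasurable (fun t => G (t, θ)) (MeasureTheory.volume.restrict (Set.uIoc (0:ℝ) T)) :=
    fun G h θ hθ => ((aux_slice_cont h hθ).mono hI).aestronglyMeasurable measurableSet_uIoc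
  refine (intervalIntegral.hasDerivAt_integral_of_dominated_loc_of_deriv_le
    (F := fun θ t => G (t, θ)) (F' := fun θ t => G1 (t, θ)) (bound := fun _ => C)
    (s := Icc a b) (Icc_mem_nhds ha2 hb1) ?_ ?_ ?_ ?_ ?_ ?_).2
  · filter_upwards [isOpen_Ioo.mem_nhds hθ] with s hs using hm G h s hs
  · apply ContinuousOn.intervalIntegrable
    rw [uIcc_of_le hT.le]
    exact aux_slice_cont h hθ
  · exact hm G1 h1 θ hθ
  · exact Eventually.of_forall fun t ht s hs => hC t (hI ht) s hs
  · simp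
  · exact Eventually.of_forall fun t ht s hs => hd t (hI ht) s (Icc_subset_Ioo ha1 hb2 hs)

/-- mean value inequality from zero -/
lemma aux_mv {F : Type*} [NormedAddCommGroup F] [NormedSpace ℝ F] {ρ C : ℝ} {G G1 : ℝ → F}
    (hd : ∀ θ ∈ Icc (-ρ) ρ, HasDerivAt G (G1 θ) θ) (h0 : G 0 = 0) {θ : ℝ} (hθ : θ ∈ Icc (-ρ) ρ)
    (hb : ∀ s, |s| ≤ |θ| → ‖G1 s‖ ≤ C) : ‖G θ‖ ≤ C * |θ| := by
  have hθ' : |θ| ≤ ρ := abs_le.2 hθ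
  have := (convex_Icc (-|θ|) |θ|).norm_image_sub_le_of_norm_hasDerivWithin_le (f := G) (f' := G1)
    (C := C) (x := 0) (y := θ)
    (fun s hs => (hd s (abs_le.1 ((abs_le.2 hs).trans hθ'))).hasDerivWithinAt)
    (fun s hs => hb s (abs_le.2 hs)) ⟨by simp, by simp⟩ (abs_le.1 le_rfl)
  simpa [h0] using this

lemma aux_ustar {P : Type*} [NormedAddCommGroup P] [NormedSpace ℝ P] [CompleteSpace P]
    {m : ℕ} (H : P × E m → ℝ) (hH : ContDiff ℝ 3 H) {δ : ℝ} (hδ : 0 < δ)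
    (hconv : ∀ y ω, ∀ c : E m, δ * ‖c‖ ^ 2 ≤ iteratedFDeriv ℝ 2 (fun ω' => H (y, ω')) ω ![c, c])
    (us : P → E m) (hus : ∀ y ω, H (y, us y) ≤ H (y, ω)) :
    ContDiff ℝ 2 us ∧ ∀ y c, fderiv ℝ H (y, us y) (0, c) = 0 := by
  set N : P × E m → (E m →L[ℝ] ℝ) := fun q => fderiv ℝ H q ∘L .inr ℝ P (E m) with hN
  have hNd : ContDiff ℝ 2 N := by
    have : ContDiff ℝ 2 (fderiv ℝ H) := hH.fderiv_right (by norm_num)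
    exact this.clm_comp contDiff_const
  have hNe : ∀ y ω, fderiv ℝ (fun ω' => H (y, ω')) ω = N (y, ω) := by
    intro y ω
    have h1 : HasFDerivAt H (fderiv ℝ H (y, ω)) (y, ω) :=
      (hH.differentiable (by norm_num) _).hasFDerivAt
    exact (h1.comp ω (hasFDerivAt_prodMk_right y ω)).fderiv
  have hNN : ∀ y ω c, δ * ‖c‖ ^ 2 ≤ fderiv ℝ N (y, ω) (0, c) c := by
    intro y ω c
    have h := hconv y ω c
    rw [iteratedFDeriv_two_apply] at h
    have e : fderiv ℝ (fun ω' => H (y, ω')) = fun ω => N (y, ω) := funext (hNe y)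
    rw [e] at h
    have h1 : HasFDerivAt N (fderiv ℝ N (y, ω)) (y, ω) :=
      (hNd.differentiable (by norm_num) _).hasFDerivAt
    have h2 := (h1.comp ω (hasFDerivAt_prodMk_right y ω)).fderiv
    have h3 : fderiv ℝ (fun ω => N (y, ω)) ω = fderiv ℝ N (y, ω) ∘L .inr ℝ P (E m) := h2
    rw [h3] at h
    simpa using h
  have hz : ∀ y, N (y, us y) = 0 := by
    intro y
    rw [← hNe]
    exact IsLocalMin.fderiv_eq_zero (Eventually.of_forall fun ω => hus y ω)
  have huniq : ∀ y ω, N (y, ω) = 0 → us y = ω := by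
    intro y ω hω
    by_contra hne
    set c := us y - ω with hc
    have hc0 : 0 < ‖c‖ := norm_pos_iff.2 (sub_ne_zero.2 hne)
    have hd : ∀ s : ℝ, HasDerivAt (fun s : ℝ => N (y, ω + s • c) c)
        (fderiv ℝ N (y, ω + s • c) (0, c) c) s := by
      intro s
      have h1 : HasFDerivAt N (fderiv ℝ N (y, ω + s • c)) (y, ω + s • c) :=
        (hNd.differentiable (by norm_num) _).hasFDerivAt
      have h2 : HasDerivAt (fun s : ℝ => (y, ω + s • c)) ((0 : P), c) s := by
        refine (hasDerivAt_const s y).prodMk ?_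
        simpa using ((hasDerivAt_id s).smul_const c).const_add ω
      have h3 := h1.comp_hasDerivAt s h2
      simpa using h3.clm_apply (hasDerivAt_const s c)
    have hmono : StrictMono (fun s : ℝ => N (y, ω + s • c) c) := by
      apply strictMono_of_hasDerivAt_pos hd
      intro s
      exact lt_of_lt_of_le (by positivity) (hNN y _ c)
    have := hmono (zero_lt_one)
    simp [hω, hc, hz] at this
  refine ⟨?_, fun y c => by simpa [hN] using congrArg (fun A => A c) (hz y)⟩
  rw [contDiff_iff_contDiffAt]
  intro y
  have hinv : (fderiv ℝ N (y, us y) ∘L .inr ℝ P (E m)).IsInvertible := by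
    set A := fderiv ℝ N (y, us y) ∘L .inr ℝ P (E m) with hA
    have hinj : Function.Injective (A : E m →ₗ[ℝ] (E m →L[ℝ] ℝ)) := by
      rw [injective_iff_map_eq_zero]
      intro c hc
      have h1 := hNN y (us y) c
      have h2 : fderiv ℝ N (y, us y) (0, c) = 0 := by simpa [hA] using hc
      rw [h2] at h1
      have h4 : ‖c‖ ^ 2 ≤ 0 := by
        by_contra h5
        push Not at h5
        have := mul_pos hδ h5
        simp at h1; linarith
      simpa using h4
    have hdim : Module.finrank ℝ (E m) = Module.finrank ℝ (E m →L[ℝ] ℝ) :=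
      (InnerProductSpace.toDual ℝ (E m)).toLinearEquiv.finrank_eq
    let e := LinearEquiv.ofInjectiveOfFinrankEq (A : E m →ₗ[ℝ] (E m →L[ℝ] ℝ)) hinj hdim
    exact ⟨e.toContinuousLinearEquiv, by ext; rfl⟩
  have hNa : ContDiffAt ℝ 2 N (y, us y) := hNd.contDiffAt
  have h1 := hNa.contDiffAt_implicitFunction (by norm_num) hinv
  refine h1.congr_of_eventuallyEq ?_
  filter_upwards [hNa.eventually_apply_implicitFunction (by norm_num) hinv] with y' hy'
  exact huniq _ _ (by rw [hy', hz])


lemma aux_lip {V F : Type*} [NormedAddCommGroup V] [NormedSpace ℝ V] [FiniteDimensional ℝ V]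
    [NormedAddCommGroup F] [NormedSpace ℝ F] {G : V → F} (hG : ContDiff ℝ 1 G) (R : ℝ) :
    ∃ K : ℝ, 0 ≤ K ∧ ∀ a b : V, ‖a‖ ≤ R → ‖b‖ ≤ R → ‖G a - G b‖ ≤ K * ‖a - b‖ := by
  have : ProperSpace V := FiniteDimensional.proper ℝ V
  obtain ⟨K, hK⟩ := (hG.contDiffOn (s := Metric.closedBall 0 R)).exists_lipschitzOnWith
    (by norm_num) (convex_closedBall _ _) (isCompact_closedBall _ _)
  refine ⟨K, K.2, fun a b ha hb => ?_⟩
  exact hK.norm_sub_le (by simpa using ha) (by simpa using hb)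

/-- first derivative vanishes for quadratically small curves -/
lemma aux_deriv_zero {F : Type*} [NormedAddCommGroup F] [NormedSpace ℝ F] {ρ C : ℝ} (hρ : 0 < ρ)
    {G : ℝ → F} {G' : F} (hd : HasDerivAt G G' 0) (hb : ∀ θ ∈ Icc (-ρ) ρ, ‖G θ‖ ≤ C * θ ^ 2) :
    G' = 0 := by
  have h0 : G 0 = 0 := by
    have := hb 0 ⟨by linarith, hρ.le⟩
    simpa using this
  have h2 : HasDerivAt G 0 0 := by
    rw [hasDerivAt_iff_isLittleO]
    have : (fun θ : ℝ => G θ) =O[𝓝 0] (fun θ : ℝ => θ ^ 2) := by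
      refine Asymptotics.IsBigO.of_bound C ?_
      filter_upwards [Icc_mem_nhds (neg_lt_zero.2 hρ) hρ] with θ hθ
      simpa using hb θ hθ
    have h3 : (fun θ : ℝ => θ ^ 2) =o[𝓝 0] (fun θ : ℝ => θ) := by
      simpa using (Asymptotics.isLittleO_pow_id (𝕜 := ℝ) (n := 2) (by norm_num))
    simpa [h0] using this.trans_isLittleO h3
  exact hd.unique h2

set_option maxSynthPendingDepth 5 in
set_option synthInstance.maxHeartbeats 400000 in
set_option maxHeartbeats 2000000 in
lemma aux_taylor {V : Type*} [NormedAddCommGroup V] [NormedSpace ℝ V] [FiniteDimensional ℝ V]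
    (H : V → ℝ) (hH : ContDiff ℝ 3 H) {T r ρ C : ℝ} (hT : 0 < T) (X Y : ℝ × ℝ → V)
    (hX : ContDiffOn ℝ 2 X (Icc 0 T ×ˢ Ioo (-r) r)) (hY : ContDiffOn ℝ 2 Y (Icc 0 T ×ˢ Ioo (-r) r))
    (hρ : 0 < ρ) (hρr : ρ < r)
    (hC : 0 ≤ C)
    (hb : ∀ t ∈ Icc 0 T, ∀ θ ∈ Icc (-ρ) ρ, ‖X (t, θ) - Y (t, θ)‖ ≤ C * θ ^ 2) :
    ∃ Φ1 Φ2 : ℝ × ℝ → ℝ,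
      ContinuousOn (fun q => H (X q) - H (Y q) - fderiv ℝ H (Y q) (X q - Y q))
        (Icc 0 T ×ˢ Ioo (-r) r) ∧
      ContinuousOn Φ1 (Icc 0 T ×ˢ Ioo (-r) r) ∧ ContinuousOn Φ2 (Icc 0 T ×ˢ Ioo (-r) r) ∧
      (∀ t ∈ Icc 0 T, ∀ θ ∈ Ioo (-r) r, HasDerivAt
        (fun s => H (X (t, s)) - H (Y (t, s)) - fderiv ℝ H (Y (t, s)) (X (t, s) - Y (t, s)))
          (Φ1 (t, θ)) θ) ∧
      (∀ t ∈ Icc 0 T, ∀ θ ∈ Ioo (-r) r, HasDerivAt (fun s => Φ1 (t, s)) (Φ2 (t, θ)) θ) ∧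
      ∃ C', ∀ t ∈ Icc 0 T, ∀ θ ∈ Icc (-ρ) ρ, ‖Φ2 (t, θ)‖ ≤ C' * θ ^ 2 := by
  obtain ⟨X1, hX1, dX⟩ := aux_partial hT 1 X (by exact_mod_cast hX)
  obtain ⟨Y1, hY1, dY⟩ := aux_partial hT 1 Y (by exact_mod_cast hY)
  obtain ⟨X2, hX2, dX1⟩ := aux_partial hT 0 X1 (by exact_mod_cast hX1)
  obtain ⟨Y2, hY2, dY1⟩ := aux_partial hT 0 Y1 (by exact_mod_cast hY1)
  have cX := hX.continuousOn
  have cY := hY.continuousOn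
  have cX1 := hX1.continuousOn
  have cY1 := hY1.continuousOn
  have cX2 := hX2.continuousOn
  have cY2 := hY2.continuousOn
  set D1 := fderiv ℝ H with hD1
  have sD1 : ContDiff ℝ 2 D1 := hH.fderiv_right (by norm_num)
  set D2 := fderiv ℝ D1 with hD2
  have sD2 : ContDiff ℝ 1 D2 := sD1.fderiv_right (by norm_num)
  set D3 := fderiv ℝ D2 with hD3
  have sD3 : ContDiff ℝ 0 D3 := sD2.fderiv_right (by norm_num)
  have dH : ∀ a, HasFDerivAt H (D1 a) a := fun a =>
    (hH.differentiable (by norm_num) a).hasFDerivAt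
  have dD1 : ∀ a, HasFDerivAt D1 (D2 a) a := fun a =>
    (sD1.differentiable (by norm_num) a).hasFDerivAt
  have dD2 : ∀ a, HasFDerivAt D2 (D3 a) a := fun a =>
    (sD2.differentiable (by norm_num) a).hasFDerivAt
  have symm : ∀ a v w, D2 a v w = D2 a w v := fun a v w =>
    second_derivative_symmetric (f := H) (f' := D1) dH (dD1 a) v w
  have cH := hH.continuous
  have cD1 := sD1.continuous
  have cD2 := sD2.continuous
  have cD3 := sD3.continuous
  have cD1X := cD1.comp_continuousOn cX
  have cD1Y := cD1.comp_continuousOn cY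
  have cD2X := cD2.comp_continuousOn cX
  have cD2Y := cD2.comp_continuousOn cY
  have cD3Y := cD3.comp_continuousOn cY
  have cΔ := cX.sub cY
  refine ⟨fun q => (D1 (X q) - D1 (Y q)) (X1 q) - D2 (Y q) (Y1 q) (X q - Y q),
    fun q => (D2 (X q) (X1 q) - D2 (Y q) (Y1 q)) (X1 q) + (D1 (X q) - D1 (Y q)) (X2 q)
      - ((D3 (Y q) (Y1 q) (Y1 q) + D2 (Y q) (Y2 q)) (X q - Y q)
        + D2 (Y q) (Y1 q) (X1 q - Y1 q)), ?_, ?_, ?_, ?_, ?_, ?_⟩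
  · exact ((cH.comp_continuousOn cX).sub (cH.comp_continuousOn cY)).sub (cD1Y.clm_apply cΔ)
  · exact ((cD1X.sub cD1Y).clm_apply cX1).sub ((cD2Y.clm_apply cY1).clm_apply cΔ)
  · exact ((((cD2X.clm_apply cX1).sub (cD2Y.clm_apply cY1)).clm_apply cX1).add
      ((cD1X.sub cD1Y).clm_apply cX2)).sub
      ((((((cD3Y.clm_apply cY1).clm_apply cY1).add (cD2Y.clm_apply cY2))).clm_apply cΔ).add
        ((cD2Y.clm_apply cY1).clm_apply (cX1.sub cY1)))
  · intro t ht θ hθ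
    have a1 := (dH (X (t, θ))).comp_hasDerivAt θ (dX t ht θ hθ)
    have a2 := (dH (Y (t, θ))).comp_hasDerivAt θ (dY t ht θ hθ)
    have a3 := (dD1 (Y (t, θ))).comp_hasDerivAt θ (dY t ht θ hθ)
    have a4 := a3.clm_apply ((dX t ht θ hθ).sub (dY t ht θ hθ))
    refine ((a1.sub a2).sub a4).congr_deriv ?_
    simp only [Function.comp, map_sub, sub_apply, Pi.sub_apply]
    ring
  · intro t ht θ hθ
    have a1 := (dD1 (X (t, θ))).comp_hasDerivAt θ (dX t ht θ hθ)
    have a2 := (dD1 (Y (t, θ))).comp_hasDerivAt θ (dY t ht θ hθ)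
    have a3 := (dD2 (Y (t, θ))).comp_hasDerivAt θ (dY t ht θ hθ)
    have a4 := (a3.clm_apply (dY1 t ht θ hθ)).clm_apply ((dX t ht θ hθ).sub (dY t ht θ hθ))
    have a5 := (a1.sub a2).clm_apply (dX1 t ht θ hθ)
    exact (a5.sub a4)
  · have hr1 : -r < -ρ := by linarith
    have hI : Icc (-ρ) ρ ⊆ Ioo (-r) r := Icc_subset_Ioo hr1 hρr
    have h0m : (0:ℝ) ∈ Ioo (-r) r := hI ⟨by linarith, hρ.le⟩
    obtain ⟨RX, -, bX⟩ := aux_bound cX hr1 hρr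
    obtain ⟨RY, -, bY⟩ := aux_bound cY hr1 hρr
    obtain ⟨A, hA, bX1⟩ := aux_bound cX1 hr1 hρr
    obtain ⟨B, hB, bY1⟩ := aux_bound cY1 hr1 hρr
    obtain ⟨A2, hA2, bX2⟩ := aux_bound cX2 hr1 hρr
    obtain ⟨B2, hB2, bY2⟩ := aux_bound cY2 hr1 hρr
    obtain ⟨M, hM, bD2⟩ := aux_bound cD2Y hr1 hρr
    obtain ⟨N, hN, bD3⟩ := aux_bound cD3Y hr1 hρr
    obtain ⟨C1, hC1, bΔ2⟩ := aux_bound (cX2.sub cY2) hr1 hρr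
    obtain ⟨K1, hK1, l1⟩ := aux_lip (sD1.of_le (by norm_num)) (max RX RY)
    obtain ⟨K2, hK2, l2⟩ := aux_lip (sD2) (max RX RY)
    refine ⟨K2 * C * A * A + M * C1 * C1 + K1 * C * A2 + (N * B * B + M * B2) * C, ?_⟩
    intro t ht θ hθ
    have hθ' := hI hθ
    have e1 : ‖X1 (t, θ) - Y1 (t, θ)‖ ≤ C1 * |θ| := by
      refine aux_mv (ρ := ρ) (G := fun s => X1 (t, s) - Y1 (t, s))
        (G1 := fun s => X2 (t, s) - Y2 (t, s)) (fun s hs => (dX1 t ht s (hI hs)).sub (dY1 t ht s (hI hs))) ?_ hθ ?_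
      · exact aux_deriv_zero hρ ((dX t ht 0 h0m).sub (dY t ht 0 h0m)) (hb t ht)
      · intro s hs
        exact bΔ2 t ht s (abs_le.1 (hs.trans (abs_le.2 hθ)))
    have f1 := bX t ht θ hθ
    have f2 := bY t ht θ hθ
    have f3 := bX1 t ht θ hθ
    have f4 := bY1 t ht θ hθ
    have f5 := bX2 t ht θ hθ
    have f6 := bY2 t ht θ hθ
    have f7 := bD2 t ht θ hθ
    have f8 := bD3 t ht θ hθ
    have f9 := hb t ht θ hθ
    have g1 := l1 _ _ (f1.trans (le_max_left RX RY)) (f2.trans (le_max_right RX RY))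
    have g2 := l2 _ _ (f1.trans (le_max_left RX RY)) (f2.trans (le_max_right RX RY))
    simp only [Function.comp] at f7 f8
    beta_reduce
    generalize X (t, θ) = x at *
    generalize Y (t, θ) = y at *
    generalize X1 (t, θ) = x1 at *
    generalize Y1 (t, θ) = y1 at *
    generalize X2 (t, θ) = x2 at *
    generalize Y2 (t, θ) = y2 at *
    have key : (D2 x x1 - D2 y y1) x1 + (D1 x - D1 y) x2
      - ((D3 y y1 y1 + D2 y y2) (x - y) + D2 y y1 (x1 - y1)) =
      (D2 x - D2 y) x1 x1 + D2 y (x1 - y1) (x1 - y1) + (D1 x - D1 y) x2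
       - (D3 y y1 y1 + D2 y y2) (x - y) := by
      have := symm y x1 y1
      simp only [map_sub, sub_apply, add_apply]
      linarith
    rw [key]
    have hsq : |θ| * |θ| = θ ^ 2 := by rw [← sq, sq_abs]
    have t1 : ‖(D2 x - D2 y) x1 x1‖ ≤ K2 * (C * θ ^ 2) * A * A :=
      ((D2 x - D2 y).le_opNorm₂ x1 x1).trans (by
        have := g2.trans (mul_le_mul_of_nonneg_left f9 hK2)
        gcongr)
    have t2 : ‖D2 y (x1 - y1) (x1 - y1)‖ ≤ M * (C1 * |θ|) * (C1 * |θ|) :=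
      ((D2 y).le_opNorm₂ _ _).trans (by gcongr)
    have t3 : ‖(D1 x - D1 y) x2‖ ≤ K1 * (C * θ ^ 2) * A2 :=
      ((D1 x - D1 y).le_opNorm _).trans (by
        have := g1.trans (mul_le_mul_of_nonneg_left f9 hK1)
        gcongr)
    have t4 : ‖(D3 y y1 y1 + D2 y y2) (x - y)‖ ≤ (N * B * B + M * B2) * (C * θ ^ 2) := by
      refine (ContinuousLinearMap.le_opNorm _ _).trans ?_
      have : ‖D3 y y1 y1 + D2 y y2‖ ≤ N * B * B + M * B2 := by
        refine (norm_add_le _ _).trans (add_le_add ?_ ?_)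
        · exact ((D3 y).le_opNorm₂ _ _).trans (by gcongr)
        · exact ((D2 y).le_opNorm _).trans (by gcongr)
      gcongr
    calc _ ≤ ‖(D2 x - D2 y) x1 x1‖ + ‖D2 y (x1 - y1) (x1 - y1)‖ + ‖(D1 x - D1 y) x2‖ +
          ‖(D3 y y1 y1 + D2 y y2) (x - y)‖ := by
          refine (norm_sub_le _ _).trans ?_
          gcongr
          exact norm_add₃_le
      _ ≤ K2 * (C * θ ^ 2) * A * A + M * (C1 * |θ|) * (C1 * |θ|) + K1 * (C * θ ^ 2) * A2 +
          (N * B * B + M * B2) * (C * θ ^ 2) := by gcongr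
      _ = _ := by
          have : M * (C1 * |θ|) * (C1 * |θ|) = M * C1 * C1 * θ ^ 2 := by rw [← hsq]; ring
          rw [this]; ring


/-- the Hamiltonian -/
def Ham {n m : ℕ} (L : E n → E m → ℝ) (f : E n → E m → E n) (a : (E n × E n) × E m) : ℝ :=
  L a.1.1 a.2 + ⟪a.1.2, f a.1.1 a.2⟫_ℝ

structure Sys {n m : ℕ} (T r : ℝ) (L : E n → E m → ℝ) (f : E n → E m → E n) (ψ : E n → ℝ)
    (xx yy pp P : ℝ × ℝ → E n) (uu : ℝ × ℝ → E m) : Prop where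
  hT : 0 < T
  hr : 0 < r
  sL : ContDiff ℝ 3 (fun q : E n × E m => L q.1 q.2)
  sf : ContDiff ℝ 3 (fun q : E n × E m => f q.1 q.2)
  sψ : ContDiff ℝ 3 ψ
  sx : ContDiffOn ℝ 3 xx (Icc 0 T ×ˢ Ioo (-r) r)
  sy : ContDiffOn ℝ 3 yy (Icc 0 T ×ˢ Ioo (-r) r)
  sp : ContDiffOn ℝ 3 pp (Icc 0 T ×ˢ Ioo (-r) r)
  su : ContDiffOn ℝ 2 uu (Icc 0 T ×ˢ Ioo (-r) r)
  cP : ContinuousOn P (Icc 0 T ×ˢ Ioo (-r) r)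
  ox : ∀ t ∈ Icc 0 T, ∀ θ ∈ Ioo (-r) r, HasDerivAt (fun s => xx (s, θ)) (f (xx (t, θ)) (uu (t, θ))) t
  oy : ∀ t ∈ Icc 0 T, ∀ θ ∈ Ioo (-r) r, HasDerivAt (fun s => yy (s, θ)) (f (yy (t, θ)) (uu (t, θ))) t
  op : ∀ t ∈ Icc 0 T, ∀ θ ∈ Ioo (-r) r, HasDerivAt (fun s => pp (s, θ)) (P (t, θ)) t
  hP : ∀ t ∈ Icc 0 T, ∀ θ ∈ Ioo (-r) r, ∀ h, fderiv ℝ (Ham L f) ((xx (t, θ), pp (t, θ)), uu (t, θ)) ((h, 0), 0)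
    = - ⟪P (t, θ), h⟫_ℝ
  stat : ∀ t ∈ Icc 0 T, ∀ θ ∈ Ioo (-r) r, ∀ c, fderiv ℝ (Ham L f) ((xx (t, θ), pp (t, θ)), uu (t, θ)) (0, c) = 0
  pT : ∀ θ ∈ Ioo (-r) r, ∀ h, fderiv ℝ ψ (xx (T, θ)) h = ⟪pp (T, θ), h⟫_ℝ
  y0 : ∀ θ ∈ Ioo (-r) r, yy (0, θ) = xx (0, 0)

lemma Ham_contDiff {n m : ℕ} {L : E n → E m → ℝ} {f : E n → E m → E n}
    (sL : ContDiff ℝ 3 (fun q : E n × E m => L q.1 q.2))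
    (sf : ContDiff ℝ 3 (fun q : E n × E m => f q.1 q.2)) : ContDiff ℝ 3 (Ham L f) := by
  have h1 : ContDiff ℝ 3 (fun a : (E n × E n) × E m => (a.1.1, a.2)) := by fun_prop
  have h2 : ContDiff ℝ 3 (fun a : (E n × E n) × E m => a.1.2) := by fun_prop
  exact (sL.comp h1).add (h2.inner ℝ (sf.comp h1))

namespace Sys
variable {n m : ℕ} {T r : ℝ} {L : E n → E m → ℝ} {f : E n → E m → E n} {ψ : E n → ℝ}
    {xx yy pp P : ℝ × ℝ → E n} {uu : ℝ × ℝ → E m}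

lemma J_deriv (S : Sys T r L f ψ xx yy pp P uu) {x1 : ℝ × ℝ → E n}
    (cx1 : ContinuousOn x1 (Icc 0 T ×ˢ Ioo (-r) r))
    (dx : ∀ t ∈ Icc 0 T, ∀ θ ∈ Ioo (-r) r, HasDerivAt (fun s => xx (t, s)) (x1 (t, θ)) θ)
    {θ0 : ℝ} (hθ0 : θ0 ∈ Ioo (-r) r) :
    HasDerivAt (fun θ => (∫ t in (0 : ℝ)..T, L (xx (t, θ)) (uu (t, θ))) + ψ (xx (T, θ)))
      ⟪pp (0, θ0), x1 (0, θ0)⟫_ℝ θ0 := by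
  obtain ⟨u1, su1, du⟩ := aux_partial S.hT 1 uu (by exact_mod_cast S.su)
  have cu1 := su1.continuousOn
  have cx := S.sx.continuousOn
  have cu := S.su.continuousOn
  have cp := S.sp.continuousOn
  have cP := S.cP
  have sH := Ham_contDiff S.sL S.sf
  have hT := S.hT
  have m0 : (0 : ℝ) ∈ Icc 0 T := ⟨le_rfl, hT.le⟩
  have mT : T ∈ Icc 0 T := ⟨hT.le, le_rfl⟩
  have hpr : ContinuousOn (fun q : ℝ × ℝ => (q.1, θ0)) (Icc 0 T ×ˢ Ioo (-r) r) := by fun_prop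
  have cp0 : ContinuousOn (fun q : ℝ × ℝ => pp (q.1, θ0)) (Icc 0 T ×ˢ Ioo (-r) r) :=
    cp.comp hpr (fun q hq => ⟨hq.1, hθ0⟩)
  have cP0 : ContinuousOn (fun q : ℝ × ℝ => P (q.1, θ0)) (Icc 0 T ×ˢ Ioo (-r) r) :=
    cP.comp hpr (fun q hq => ⟨hq.1, hθ0⟩)
  have cfx : ContinuousOn (fun q => f (xx q) (uu q)) (Icc 0 T ×ˢ Ioo (-r) r) :=
    S.sf.continuous.comp_continuousOn (cx.prodMk cu)
  set A : ℝ × ℝ → (E n × E n) × E m := fun q => ((xx q, pp (q.1, θ0)), uu q) with hA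
  have cA : ContinuousOn A (Icc 0 T ×ˢ Ioo (-r) r) := (cx.prodMk cp0).prodMk cu
  set K : ℝ × ℝ → ℝ := fun q => Ham L f (A q) + ⟪P (q.1, θ0), xx q⟫_ℝ with hK
  set K1 : ℝ × ℝ → ℝ := fun q => fderiv ℝ (Ham L f) (A q) ((x1 q, 0), u1 q)
    + ⟪P (q.1, θ0), x1 q⟫_ℝ with hK1
  have cK : ContinuousOn K (Icc 0 T ×ˢ Ioo (-r) r) :=
    (sH.continuous.comp_continuousOn cA).add (cP0.inner cx)
  have cK1 : ContinuousOn K1 (Icc 0 T ×ˢ Ioo (-r) r) :=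
    (((sH.continuous_fderiv (by norm_num)).comp_continuousOn cA).clm_apply
      ((cx1.prodMk continuousOn_const).prodMk cu1)).add (cP0.inner cx1)
  have dK : ∀ t ∈ Icc 0 T, ∀ θ ∈ Ioo (-r) r, HasDerivAt (fun s => K (t, s)) (K1 (t, θ)) θ := by
    intro t ht θ hθ
    have a1 : HasDerivAt (fun s => A (t, s)) ((x1 (t, θ), 0), u1 (t, θ)) θ :=
      ((dx t ht θ hθ).prodMk (hasDerivAt_const θ (pp (t, θ0)))).prodMk (du t ht θ hθ)
    have a2 : HasFDerivAt (Ham L f) (fderiv ℝ (Ham L f) (A (t, θ))) (A (t, θ)) :=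
      (sH.differentiable (by norm_num) _).hasFDerivAt
    have a3 := a2.comp_hasDerivAt θ a1
    have a4 := (hasDerivAt_const θ (P (t, θ0))).inner ℝ (dx t ht θ hθ)
    refine (a3.add a4).congr_deriv ?_
    simp [hK1]
  have hI := aux_integral hT cK cK1 dK hθ0
  have hK10 : ∀ t ∈ Icc 0 T, K1 (t, θ0) = 0 := by
    intro t ht
    have e : (((x1 (t, θ0), 0), u1 (t, θ0)) : (E n × E n) × E m)
      = ((x1 (t, θ0), 0), 0) + (0, u1 (t, θ0)) := by simp
    simp only [hK1, hA]
    rw [e, map_add, S.hP t ht θ0 hθ0, S.stat t ht θ0 hθ0]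
    ring
  have hI0 : (∫ t in (0 : ℝ)..T, K1 (t, θ0)) = 0 := by
    rw [intervalIntegral.integral_congr (g := fun _ => (0:ℝ))]
    · simp
    · intro t ht
      rw [uIcc_of_le hT.le] at ht
      exact hK10 t ht
  rw [hI0] at hI
  have key : ∀ θ ∈ Ioo (-r) r, (∫ t in (0 : ℝ)..T, L (xx (t, θ)) (uu (t, θ)))
      = (∫ t in (0 : ℝ)..T, K (t, θ)) - (⟪pp (T, θ0), xx (T, θ)⟫_ℝ - ⟪pp (0, θ0), xx (0, θ)⟫_ℝ) := by
    intro θ hθ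
    set B : ℝ → ℝ := fun t => ⟪pp (t, θ0), f (xx (t, θ)) (uu (t, θ))⟫_ℝ + ⟪P (t, θ0), xx (t, θ)⟫_ℝ with hB
    have cB : ContinuousOn B (Icc 0 T) :=
      ((aux_slice_cont cp hθ0).inner (aux_slice_cont cfx hθ)).add
        ((aux_slice_cont cP hθ0).inner (aux_slice_cont cx hθ))
    have iB : IntervalIntegrable B MeasureTheory.volume 0 T := by
      apply ContinuousOn.intervalIntegrable; rwa [uIcc_of_le hT.le]
    have iK : IntervalIntegrable (fun t => K (t, θ)) MeasureTheory.volume 0 T := by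
      apply ContinuousOn.intervalIntegrable; rw [uIcc_of_le hT.le]; exact aux_slice_cont cK hθ
    have h1 : (∫ t in (0 : ℝ)..T, B t) = ⟪pp (T, θ0), xx (T, θ)⟫_ℝ - ⟪pp (0, θ0), xx (0, θ)⟫_ℝ := by
      refine intervalIntegral.integral_eq_sub_of_hasDerivAt
        (f := fun t => ⟪pp (t, θ0), xx (t, θ)⟫_ℝ) ?_ iB
      intro t ht
      rw [uIcc_of_le hT.le] at ht
      exact (S.op t ht θ0 hθ0).inner ℝ (S.ox t ht θ hθ)
    rw [← h1, ← intervalIntegral.integral_sub iK iB]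
    refine intervalIntegral.integral_congr fun t _ => ?_
    simp only [hK, hA, hB, Ham]
    ring
  have b1 := (hasDerivAt_const θ0 (pp (T, θ0))).inner ℝ (dx T mT θ0 hθ0)
  have b2 := (hasDerivAt_const θ0 (pp (0, θ0))).inner ℝ (dx 0 m0 θ0 hθ0)
  have b3 : HasDerivAt (fun θ => ψ (xx (T, θ))) (fderiv ℝ ψ (xx (T, θ0)) (x1 (T, θ0))) θ0 :=
    ((S.sψ.differentiable (by norm_num) _).hasFDerivAt).comp_hasDerivAt θ0 (dx T mT θ0 hθ0)
  rw [S.pT θ0 hθ0] at b3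
  have b4 := (hI.sub (b1.sub b2)).add b3
  refine (b4.congr_of_eventuallyEq ?_).congr_deriv ?_
  · filter_upwards [isOpen_Ioo.mem_nhds hθ0] with θ hθ
    simp only [Pi.add_apply, Pi.sub_apply]
    rw [key θ hθ]
  · simp

lemma diff_bound (S : Sys T r L f ψ xx yy pp P uu) {x1 : ℝ × ℝ → E n}
    (sx1 : ContDiffOn ℝ 2 x1 (Icc 0 T ×ˢ Ioo (-r) r))
    (dx : ∀ t ∈ Icc 0 T, ∀ θ ∈ Ioo (-r) r, HasDerivAt (fun s => xx (t, s)) (x1 (t, θ)) θ)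
    (hz : x1 (0, 0) = 0) {ρ : ℝ} (hρ : 0 < ρ) (hρr : ρ < r) :
    ∃ C, 0 ≤ C ∧ ∀ t ∈ Icc 0 T, ∀ θ ∈ Icc (-ρ) ρ, ‖yy (t, θ) - xx (t, θ)‖ ≤ C * θ ^ 2 := by
  have hT := S.hT
  obtain ⟨x2, sx2, dx1⟩ := aux_partial hT 1 x1 (by exact_mod_cast sx1)
  have m0 : (0 : ℝ) ∈ Icc 0 T := ⟨le_rfl, hT.le⟩
  have cx := S.sx.continuousOn
  have cy := S.sy.continuousOn
  have cu := S.su.continuousOn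
  have hr1 : -r < -ρ := by linarith
  have hI : Icc (-ρ) ρ ⊆ Ioo (-r) r := Icc_subset_Ioo hr1 hρr
  obtain ⟨R1, -, b1⟩ := aux_bound (cx.prodMk cu) hr1 hρr
  obtain ⟨R2, -, b2⟩ := aux_bound (cy.prodMk cu) hr1 hρr
  obtain ⟨K, hK, lf⟩ := aux_lip (S.sf.of_le (by norm_num)) (max R1 R2)
  obtain ⟨C, hC, b3⟩ := aux_bound sx2.continuousOn hr1 hρr
  refine ⟨C * Real.exp (K * T), by positivity, fun t ht θ hθ => ?_⟩
  have e1 : ∀ s ∈ Icc (-ρ) ρ, ‖x1 (0, s)‖ ≤ C * |s| := fun s hs =>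
    aux_mv (G := fun s => x1 (0, s)) (fun a ha => dx1 0 m0 a (hI ha)) hz hs
      (fun a ha => b3 0 m0 a (abs_le.1 (ha.trans (abs_le.2 hs))))
  have e2 : ‖xx (0, θ) - xx (0, 0)‖ ≤ (C * |θ|) * |θ| :=
    aux_mv (G := fun s => xx (0, s) - xx (0, 0)) (ρ := ρ)
      (fun a ha => (dx 0 m0 a (hI ha)).sub_const _) (by simp) hθ
      (fun a ha => (e1 a (abs_le.1 (ha.trans (abs_le.2 hθ)))).trans (by gcongr))
  have hsq : |θ| * |θ| = θ ^ 2 := by rw [← sq, sq_abs]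
  have e3 : ‖yy (0, θ) - xx (0, θ)‖ ≤ C * θ ^ 2 := by
    rw [S.y0 θ (hI hθ), norm_sub_rev, ← hsq, ← mul_assoc]; exact e2
  have g := norm_le_gronwallBound_of_norm_deriv_right_le (f := fun t => yy (t, θ) - xx (t, θ))
    (f' := fun t => f (yy (t, θ)) (uu (t, θ)) - f (xx (t, θ)) (uu (t, θ))) (a := 0) (b := T)
    (δ := C * θ ^ 2) (K := K) (ε := 0)
    ((aux_slice_cont cy (hI hθ)).sub (aux_slice_cont cx (hI hθ)))
    (fun s hs => ((S.oy s (Ico_subset_Icc_self hs) θ (hI hθ)).sub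
      (S.ox s (Ico_subset_Icc_self hs) θ (hI hθ))).hasDerivWithinAt) e3 (fun s hs => by
      have hs' := Ico_subset_Icc_self hs
      have := lf (yy (s, θ), uu (s, θ)) (xx (s, θ), uu (s, θ))
        ((b2 s hs' θ hθ).trans (le_max_right _ _)) ((b1 s hs' θ hθ).trans (le_max_left _ _))
      simpa [Prod.norm_def] using this) t ht
  rw [gronwallBound_ε0] at g
  refine g.trans ?_
  have : Real.exp (K * (t - 0)) ≤ Real.exp (K * T) := by
    apply Real.exp_le_exp.2; rw [sub_zero]; exact mul_le_mul_of_nonneg_left ht.2 hK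
  calc C * θ ^ 2 * Real.exp (K * (t - 0)) ≤ C * θ ^ 2 * Real.exp (K * T) := by gcongr
    _ = _ := by ring

/-- the cost identity -/
lemma cost_eq (S : Sys T r L f ψ xx yy pp P uu) {θ : ℝ} (hθ : θ ∈ Ioo (-r) r) :
    (∫ t in (0 : ℝ)..T, L (yy (t, θ)) (uu (t, θ))) + ψ (yy (T, θ)) =
    ((∫ t in (0 : ℝ)..T, L (xx (t, θ)) (uu (t, θ))) + ψ (xx (T, θ)))
    + ((∫ t in (0 : ℝ)..T, (Ham L f ((yy (t, θ), pp (t, θ)), uu (t, θ))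
          - Ham L f ((xx (t, θ), pp (t, θ)), uu (t, θ))
          - fderiv ℝ (Ham L f) ((xx (t, θ), pp (t, θ)), uu (t, θ))
            (((yy (t, θ), pp (t, θ)), uu (t, θ)) - ((xx (t, θ), pp (t, θ)), uu (t, θ)))))
      + (ψ (yy (T, θ)) - ψ (xx (T, θ)) - fderiv ℝ ψ (xx (T, θ)) (yy (T, θ) - xx (T, θ))))
    - ⟪pp (0, θ), xx (0, θ) - xx (0, 0)⟫_ℝ := by
  have hT := S.hT
  have cx := aux_slice_cont S.sx.continuousOn hθ
  have cy := aux_slice_cont S.sy.continuousOn hθ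
  have cu := aux_slice_cont S.su.continuousOn hθ
  have cp := aux_slice_cont S.sp.continuousOn hθ
  have cP := aux_slice_cont S.cP hθ
  have cfx : ContinuousOn (fun t => f (xx (t, θ)) (uu (t, θ))) (Icc 0 T) :=
    S.sf.continuous.comp_continuousOn (cx.prodMk cu)
  have cfy : ContinuousOn (fun t => f (yy (t, θ)) (uu (t, θ))) (Icc 0 T) :=
    S.sf.continuous.comp_continuousOn (cy.prodMk cu)
  have cLx : ContinuousOn (fun t => L (xx (t, θ)) (uu (t, θ))) (Icc 0 T) :=
    S.sL.continuous.comp_continuousOn (cx.prodMk cu)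
  have cLy : ContinuousOn (fun t => L (yy (t, θ)) (uu (t, θ))) (Icc 0 T) :=
    S.sL.continuous.comp_continuousOn (cy.prodMk cu)
  have ii : ∀ B : ℝ → ℝ, ContinuousOn B (Icc 0 T) → IntervalIntegrable B MeasureTheory.volume 0 T := by
    intro B hB
    apply ContinuousOn.intervalIntegrable; rwa [uIcc_of_le hT.le]
  set B : ℝ → ℝ := fun t => ⟪pp (t, θ), f (yy (t, θ)) (uu (t, θ)) - f (xx (t, θ)) (uu (t, θ))⟫_ℝ
    + ⟪P (t, θ), yy (t, θ) - xx (t, θ)⟫_ℝ with hB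
  have cB : ContinuousOn B (Icc 0 T) := (cp.inner (cfy.sub cfx)).add (cP.inner (cy.sub cx))
  have h1 : (∫ t in (0 : ℝ)..T, B t) = ⟪pp (T, θ), yy (T, θ) - xx (T, θ)⟫_ℝ
      - ⟪pp (0, θ), yy (0, θ) - xx (0, θ)⟫_ℝ := by
    refine intervalIntegral.integral_eq_sub_of_hasDerivAt
      (f := fun t => ⟪pp (t, θ), yy (t, θ) - xx (t, θ)⟫_ℝ) ?_ (ii B cB)
    intro t ht
    rw [uIcc_of_le hT.le] at ht
    exact (S.op t ht θ hθ).inner ℝ ((S.oy t ht θ hθ).sub (S.ox t ht θ hθ))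
  have h2 : (∫ t in (0 : ℝ)..T, (Ham L f ((yy (t, θ), pp (t, θ)), uu (t, θ))
          - Ham L f ((xx (t, θ), pp (t, θ)), uu (t, θ))
          - fderiv ℝ (Ham L f) ((xx (t, θ), pp (t, θ)), uu (t, θ))
            (((yy (t, θ), pp (t, θ)), uu (t, θ)) - ((xx (t, θ), pp (t, θ)), uu (t, θ)))))
      = ∫ t in (0 : ℝ)..T, (L (yy (t, θ)) (uu (t, θ)) - L (xx (t, θ)) (uu (t, θ)) + B t) := by
    refine intervalIntegral.integral_congr fun t ht => ?_
    rw [uIcc_of_le hT.le] at ht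
    have e : (((yy (t, θ), pp (t, θ)), uu (t, θ)) - ((xx (t, θ), pp (t, θ)), uu (t, θ)) :
      (E n × E n) × E m) = ((yy (t, θ) - xx (t, θ), 0), 0) := by simp
    simp only [e]
    rw [S.hP t ht θ hθ]
    simp only [hB, Ham, inner_sub_right]
    ring
  rw [h2, intervalIntegral.integral_add ((ii _ cLy).sub (ii _ cLx)) (ii B cB),
    intervalIntegral.integral_sub (ii _ cLy) (ii _ cLx), h1, S.pT θ hθ, S.y0 θ hθ,
    inner_sub_right, inner_sub_right, inner_sub_right]
  ring

lemma third (S : Sys T r L f ψ xx yy pp P uu) {x1 x2 p1 : ℝ × ℝ → E n}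
    (sx1 : ContDiffOn ℝ 2 x1 (Icc 0 T ×ˢ Ioo (-r) r))
    (sp1 : ContDiffOn ℝ 2 p1 (Icc 0 T ×ˢ Ioo (-r) r))
    (dx : ∀ t ∈ Icc 0 T, ∀ θ ∈ Ioo (-r) r, HasDerivAt (fun s => xx (t, s)) (x1 (t, θ)) θ)
    (dx1 : ∀ t ∈ Icc 0 T, ∀ θ ∈ Ioo (-r) r, HasDerivAt (fun s => x1 (t, s)) (x2 (t, θ)) θ)
    (dp : ∀ t ∈ Icc 0 T, ∀ θ ∈ Ioo (-r) r, HasDerivAt (fun s => pp (t, s)) (p1 (t, θ)) θ)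
    (hz : x1 (0, 0) = 0) (G : ℝ → ℝ)
    (hG : ∀ θ ∈ Ioo (-r) r, G θ =
      (∫ t in (0 : ℝ)..T, L (yy (t, θ)) (uu (t, θ))) + ψ (yy (T, θ))) :
    (∀ᶠ θ in 𝓝 (0 : ℝ), DifferentiableAt ℝ G θ) ∧ (∀ᶠ θ in 𝓝 (0 : ℝ), DifferentiableAt ℝ (deriv G) θ)
    ∧ HasDerivAt (deriv (deriv G)) (-⟪p1 (0, 0), x2 (0, 0)⟫_ℝ) 0 := by
  have hT := S.hT
  have hr := S.hr
  have m0 : (0 : ℝ) ∈ Icc 0 T := ⟨le_rfl, hT.le⟩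
  have mT : T ∈ Icc 0 T := ⟨hT.le, le_rfl⟩
  have z0 : (0 : ℝ) ∈ Ioo (-r) r := ⟨by linarith, hr⟩
  obtain ⟨p2, sp2, dp1⟩ := aux_partial hT 1 p1 (by exact_mod_cast sp1)
  obtain ⟨p3, sp3, dp2⟩ := aux_partial hT 0 p2 (by exact_mod_cast sp2)
  have hρ : 0 < r / 2 := by linarith
  have hρr : r / 2 < r := by linarith
  obtain ⟨C, hC, hb⟩ := S.diff_bound sx1 dx hz hρ hρr
  have sx' := S.sx.of_le (show (2 : WithTop ℕ∞) ≤ 3 by norm_num)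
  have sy' := S.sy.of_le (show (2 : WithTop ℕ∞) ≤ 3 by norm_num)
  have sp' := S.sp.of_le (show (2 : WithTop ℕ∞) ≤ 3 by norm_num)
  obtain ⟨Φ1, Φ2, c0, c1, c2, d0, d1, C', hC'⟩ := aux_taylor (Ham L f) (Ham_contDiff S.sL S.sf) hT
    (fun q => ((yy q, pp q), uu q)) (fun q => ((xx q, pp q), uu q))
    ((sy'.prodMk sp').prodMk S.su) ((sx'.prodMk sp').prodMk S.su) hρ hρr hC
    (fun t ht θ hθ => by simpa [Prod.norm_def] using hb t ht θ hθ)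
  obtain ⟨Ψ1, Ψ2, -, -, -, e0, e1, C'', hC''⟩ := aux_taylor ψ S.sψ hT yy xx sy' sx' hρ hρr hC hb
  have dG : ∀ θ ∈ Ioo (-r) r, HasDerivAt G ((∫ t in (0 : ℝ)..T, Φ1 (t, θ)) + Ψ1 (T, θ)
      - ⟪p1 (0, θ), xx (0, θ) - xx (0, 0)⟫_ℝ) θ := by
    intro θ hθ
    have a1 := S.J_deriv sx1.continuousOn dx hθ
    have a2 := aux_integral hT c0 c1 d0 hθ
    have a3 := e0 T mT θ hθ
    have a4 := (dp 0 m0 θ hθ).inner ℝ ((dx 0 m0 θ hθ).sub_const (xx (0, 0)))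
    refine (((a1.add (a2.add a3)).sub a4).congr_of_eventuallyEq ?_).congr_deriv ?_
    · filter_upwards [isOpen_Ioo.mem_nhds hθ] with s hs
      rw [hG s hs, S.cost_eq hs]
      rfl
    · ring
  have dG1 : ∀ θ ∈ Ioo (-r) r, HasDerivAt (deriv G) ((∫ t in (0 : ℝ)..T, Φ2 (t, θ)) + Ψ2 (T, θ)
      - (⟪p1 (0, θ), x1 (0, θ)⟫_ℝ + ⟪p2 (0, θ), xx (0, θ) - xx (0, 0)⟫_ℝ)) θ := by
    intro θ hθ
    have a2 := aux_integral hT c1 c2 d1 hθ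
    have a3 := e1 T mT θ hθ
    have a4 := (dp1 0 m0 θ hθ).inner ℝ ((dx 0 m0 θ hθ).sub_const (xx (0, 0)))
    refine ((a2.add a3).sub a4).congr_of_eventuallyEq ?_
    filter_upwards [isOpen_Ioo.mem_nhds hθ] with s hs
    exact (dG s hs).deriv
  refine ⟨?_, ?_, ?_⟩
  · filter_upwards [isOpen_Ioo.mem_nhds z0] with θ hθ using (dG θ hθ).differentiableAt
  · filter_upwards [isOpen_Ioo.mem_nhds z0] with θ hθ using (dG1 θ hθ).differentiableAt
  · have a1 : HasDerivAt (fun θ => (∫ t in (0 : ℝ)..T, Φ2 (t, θ)) + Ψ2 (T, θ)) 0 0 := by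
      have hq : ∀ θ ∈ Icc (-(r/2)) (r/2), ‖(∫ t in (0 : ℝ)..T, Φ2 (t, θ)) + Ψ2 (T, θ)‖
          ≤ (C' * T + C'') * θ ^ 2 := by
        intro θ hθ
        have i1 : ‖∫ t in (0 : ℝ)..T, Φ2 (t, θ)‖ ≤ (C' * θ ^ 2) * |T - 0| := by
          apply intervalIntegral.norm_integral_le_of_norm_le_const
          intro t ht
          rw [uIoc_of_le hT.le] at ht
          exact hC' t (Ioc_subset_Icc_self ht) θ hθ
        rw [sub_zero, abs_of_pos hT] at i1
        have i2 := hC'' T mT θ hθ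
        refine (norm_add_le _ _).trans ?_
        linarith
      have h0 : (∫ t in (0 : ℝ)..T, Φ2 (t, 0)) + Ψ2 (T, 0) = 0 := by
        have := hq 0 ⟨by linarith, by linarith⟩
        simpa using this
      rw [hasDerivAt_iff_isLittleO]
      have h3 : (fun θ : ℝ => θ ^ 2) =o[𝓝 0] (fun θ : ℝ => θ) := by
        simpa using (Asymptotics.isLittleO_pow_id (𝕜 := ℝ) (n := 2) (by norm_num))
      have h4 : (fun θ : ℝ => (∫ t in (0 : ℝ)..T, Φ2 (t, θ)) + Ψ2 (T, θ)) =O[𝓝 0]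
          (fun θ : ℝ => θ ^ 2) := by
        refine Asymptotics.IsBigO.of_bound (C' * T + C'') ?_
        filter_upwards [Icc_mem_nhds (neg_lt_zero.2 hρ) hρ] with θ hθ
        simpa using hq θ hθ
      simpa [h0] using h4.trans_isLittleO h3
    have a4 := (dp1 0 m0 0 z0).inner ℝ (dx1 0 m0 0 z0)
    have a4 := (dp 0 m0 0 z0)
    have a5 := (dp1 0 m0 0 z0).inner ℝ (dx1 0 m0 0 z0)
    have a6 := (dp2 0 m0 0 z0).inner ℝ ((dx 0 m0 0 z0).sub_const (xx (0, 0)))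
    refine ((a1.sub (a5.add a6)).congr_of_eventuallyEq ?_).congr_deriv ?_
    · filter_upwards [isOpen_Ioo.mem_nhds z0] with s hs
      exact (dG1 s hs).deriv
    · simp [hz]
end Sys

lemma Ham_conv {n m : ℕ} {L : E n → E m → ℝ} {f : E n → E m → E n} {f0 : E n → E n}
    {fi : Fin m → E n → E n} (sL : ContDiff ℝ 3 (fun q : E n × E m => L q.1 q.2))
    (hfdef : ∀ y ω, f y ω = f0 y + ∑ i, ω i • fi i y) (y : E n × E n) (ω c : E m) :
    iteratedFDeriv ℝ 2 (fun ω' => Ham L f (y, ω')) ω ![c, c]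
      = iteratedFDeriv ℝ 2 (fun ω' => L y.1 ω') ω ![c, c] := by
  set A : E m →L[ℝ] ℝ := ∑ i, ⟪y.2, fi i y.1⟫_ℝ • EuclideanSpace.proj i with hA
  have e : (fun ω' => Ham L f (y, ω')) = fun ω' => (L y.1 ω' + A ω') + ⟪y.2, f0 y.1⟫_ℝ := by
    funext ω'
    simp only [Ham, hfdef, inner_add_right, inner_sum, inner_smul_right, hA]
    simp [mul_comm]
    ring
  have sLy : ContDiff ℝ 3 (fun ω' => L y.1 ω') := by
    have h1 : ContDiff ℝ 3 (fun ω' : E m => (y.1, ω')) := by fun_prop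
    exact sL.comp h1
  have e2 : fderiv ℝ (fun ω' => Ham L f (y, ω')) = fun ω' => fderiv ℝ (fun ω' => L y.1 ω') ω' + A := by
    funext ω'
    rw [e]
    have h1 : HasFDerivAt (fun ω' => L y.1 ω') (fderiv ℝ (fun ω' => L y.1 ω') ω') ω' :=
      (sLy.differentiable (by norm_num) _).hasFDerivAt
    exact ((h1.add A.hasFDerivAt).add_const _).fderiv
  rw [iteratedFDeriv_two_apply, iteratedFDeriv_two_apply, e2, fderiv_add_const]

lemma hasDerivAt_of_inner {n : ℕ} {p : ℝ → E n} {P : E n} {t : ℝ}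
    (h : ∀ w : E n, HasDerivAt (fun s => ⟪p s, w⟫_ℝ) ⟪P, w⟫_ℝ t) : HasDerivAt p P t := by
  have h1 : HasDerivAt (fun s => (EuclideanSpace.equiv (Fin n) ℝ) (p s))
      ((EuclideanSpace.equiv (Fin n) ℝ) P) t := by
    rw [hasDerivAt_pi]
    intro i
    simpa [EuclideanSpace.inner_single_right] using h (EuclideanSpace.single i 1)
  have h2 := ((EuclideanSpace.equiv (Fin n) ℝ).symm : (Fin n → ℝ) →L[ℝ] E n).hasFDerivAt.comp_hasDerivAt t h1
  simpa [Function.comp_def] using h2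


set_option maxHeartbeats 4000000 in
/-- If `v` is a unit vector with `x_z(0,z̄) v = 0`, then the map
`θ ↦ g(z̄ + θ v, z̄)` is three times differentiable at `θ = 0` and
`g_v'''(0) = −(p_z(0,z̄) v) · (x_{zz}(0,z̄)(v,v))`. -/
theorem g_third_deriv_formula
    (n m : ℕ) (hn : 1 ≤ n) (hm : 1 ≤ m) (T : ℝ) (hT : 0 < T)
    -- the control-linear dynamics
    (f0 : E n → E n) (fi : Fin m → E n → E n)
    (hf0 : ContDiff ℝ 3 f0) (hfi : ∀ i, ContDiff ℝ 3 (fi i))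
    (c1 : ℝ) (hc1 : 0 < c1)
    (hgrowth0 : ∀ y : E n, ‖f0 y‖ ≤ c1 * (‖y‖ + 1))
    (hgrowth : ∀ i, ∀ y : E n, ‖fi i y‖ ≤ c1 * (‖y‖ + 1))
    (f : E n → E m → E n)
    (hfdef : ∀ y ω, f y ω = f0 y + ∑ i, ω i • fi i y)
    -- the running cost, three times continuously differentiable, uniformly convex in `u`
    (L : E n → E m → ℝ)
    (hL : ContDiff ℝ 3 (fun q : E n × E m => L q.1 q.2))
    (δL : ℝ) (hδL : 0 < δL)
    (hconv : ∀ y ω, ∀ c : E m,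
      δL * ‖c‖ ^ 2 ≤ iteratedFDeriv ℝ 2 (fun ω' => L y ω') ω ![c, c])
    -- `ustar y q` is the pointwise minimizer of `ω ↦ L y ω + ⟪q, f y ω⟫`
    (ustar : E n → E n → E m)
    (hustar : ∀ y q : E n, ∀ ω : E m,
      L y (ustar y q) + ⟪q, f y (ustar y q)⟫_ℝ ≤ L y ω + ⟪q, f y ω⟫_ℝ)
    -- the terminal cost
    (ψ : E n → ℝ) (hψ : ContDiff ℝ 3 ψ)
    (U : Set (E n)) (hU : IsOpen U) (zbar : E n) (hzbar : zbar ∈ U)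
    -- `(x(·,z), p(·,z))` solves the Pontryagin system with terminal data `(z, ∇ψ(z))`
    (x p : ℝ → E n → E n)
    (hxode : ∀ z ∈ U, ∀ t ∈ Set.Icc (0 : ℝ) T,
        HasDerivAt (fun s => x s z) (f (x t z) (ustar (x t z) (p t z))) t)
    (hpode : ∀ z ∈ U, ∀ t ∈ Set.Icc (0 : ℝ) T, ∀ h : E n,
        HasDerivAt (fun s => ⟪p s z, h⟫_ℝ)
          (-⟪p t z, fderiv ℝ (fun y => f y (ustar (x t z) (p t z))) (x t z) h⟫_ℝ
            - fderiv ℝ (fun y => L y (ustar (x t z) (p t z))) (x t z) h) t)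
    (hxT : ∀ z ∈ U, x T z = z)
    (hpT : ∀ z ∈ U, p T z = gradient ψ z)
    -- regularity: `x` and `p` are three times continuously differentiable
    (hxreg : ContDiffOn ℝ 3 (fun q : ℝ × E n => x q.1 q.2) (Set.Icc 0 T ×ˢ U))
    (hpreg : ContDiffOn ℝ 3 (fun q : ℝ × E n => p q.1 q.2) (Set.Icc 0 T ×ˢ U))
    -- `x̃(·,z)` starts at `x(0,z̄)` and uses the control `u(·,z) = ustar(x(·,z),p(·,z))`
    (xt : ℝ → E n → E n)
    (hxt0 : ∀ z ∈ U, xt 0 z = x 0 zbar)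
    (hxtode : ∀ z ∈ U, ∀ t ∈ Set.Icc (0 : ℝ) T,
        HasDerivAt (fun s => xt s z) (f (xt t z) (ustar (x t z) (p t z))) t)
    (hxtreg : ContDiffOn ℝ 3 (fun q : ℝ × E n => xt q.1 q.2) (Set.Icc 0 T ×ˢ U))
    -- the auxiliary cost `g(z, z̄)`
    (g : E n → ℝ)
    (hg : ∀ z, g z =
      (∫ t in (0 : ℝ)..T, L (xt t z) (ustar (x t z) (p t z))) + ψ (xt T z))
    -- `v` is a unit vector with `x_z(0, z̄) v = 0`
    (v : E n) (hv : ‖v‖ = 1)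
    (hker : fderiv ℝ (x 0) zbar v = 0) :
    (∀ᶠ θ in nhds (0 : ℝ), DifferentiableAt ℝ (fun θ' : ℝ => g (zbar + θ' • v)) θ)
    ∧ (∀ᶠ θ in nhds (0 : ℝ), DifferentiableAt ℝ (deriv fun θ' : ℝ => g (zbar + θ' • v)) θ)
    ∧ DifferentiableAt ℝ (deriv (deriv fun θ' : ℝ => g (zbar + θ' • v))) 0
    ∧ deriv (deriv (deriv fun θ' : ℝ => g (zbar + θ' • v))) 0
        = -⟪fderiv ℝ (p 0) zbar v, iteratedFDeriv ℝ 2 (x 0) zbar ![v, v]⟫_ℝ := by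
  have sf : ContDiff ℝ 3 (fun q : E n × E m => f q.1 q.2) := by
    have e : (fun q : E n × E m => f q.1 q.2) = fun q => f0 q.1 + ∑ i, q.2 i • fi i q.1 := by
      funext q; exact hfdef _ _
    rw [e]
    refine (hf0.comp contDiff_fst).add (ContDiff.sum fun i _ => ?_)
    have h1 : ContDiff ℝ 3 (fun q : E n × E m => q.2 i) := by
      exact ((EuclideanSpace.proj i : E m →L[ℝ] ℝ).contDiff).comp contDiff_snd
    exact h1.smul ((hfi i).comp contDiff_fst)
  have sH := Ham_contDiff hL sf
  obtain ⟨sus, hstat⟩ := aux_ustar (Ham L f) sH hδL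
    (fun y ω c => by rw [Ham_conv hL hfdef]; exact hconv y.1 ω c)
    (fun a => ustar a.1 a.2) (fun y ω => hustar y.1 y.2 ω)
  obtain ⟨r, hr, hrU⟩ := Metric.isOpen_iff.1 hU zbar hzbar
  have hmem : ∀ θ ∈ Ioo (-r) r, zbar + θ • v ∈ U := by
    intro θ hθ
    apply hrU
    simp only [Metric.mem_ball, dist_self_add_left, norm_smul, hv, mul_one, Real.norm_eq_abs]
    exact abs_lt.2 hθ
  have sc : ContDiffOn ℝ 3 (fun q : ℝ × ℝ => (q.1, zbar + q.2 • v)) (Icc 0 T ×ˢ Ioo (-r) r) := by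
    apply ContDiff.contDiffOn; fun_prop
  have mc : MapsTo (fun q : ℝ × ℝ => (q.1, zbar + q.2 • v)) (Icc 0 T ×ˢ Ioo (-r) r) (Icc 0 T ×ˢ U) :=
    fun q hq => ⟨hq.1, hmem _ hq.2⟩
  set xx : ℝ × ℝ → E n := fun q => x q.1 (zbar + q.2 • v) with hxx
  set yy : ℝ × ℝ → E n := fun q => xt q.1 (zbar + q.2 • v) with hyy
  set pp : ℝ × ℝ → E n := fun q => p q.1 (zbar + q.2 • v) with hpp
  set uu : ℝ × ℝ → E m := fun q => ustar (xx q) (pp q) with huu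
  have sx : ContDiffOn ℝ 3 xx (Icc 0 T ×ˢ Ioo (-r) r) := hxreg.comp sc mc
  have sy : ContDiffOn ℝ 3 yy (Icc 0 T ×ˢ Ioo (-r) r) := hxtreg.comp sc mc
  have sp : ContDiffOn ℝ 3 pp (Icc 0 T ×ˢ Ioo (-r) r) := hpreg.comp sc mc
  have su : ContDiffOn ℝ 2 uu (Icc 0 T ×ˢ Ioo (-r) r) :=
    sus.comp_contDiffOn ((sx.of_le (by norm_num)).prodMk (sp.of_le (by norm_num)))
  set ι : E n →L[ℝ] (E n × E n) × E m :=
    (ContinuousLinearMap.inl ℝ (E n × E n) (E m)) ∘L (ContinuousLinearMap.inl ℝ (E n) (E n)) with hι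
  set P : ℝ × ℝ → E n := fun q => - (InnerProductSpace.toDual ℝ (E n)).symm
    (fderiv ℝ (Ham L f) ((xx q, pp q), uu q) ∘L ι) with hPdef
  have hP : ∀ q h, fderiv ℝ (Ham L f) ((xx q, pp q), uu q) ((h, 0), 0) = - ⟪P q, h⟫_ℝ := by
    intro q h
    simp only [hPdef, inner_neg_left, neg_neg, InnerProductSpace.toDual_symm_apply]
    rfl
  have cP : ContinuousOn P (Icc 0 T ×ˢ Ioo (-r) r) := by
    have c1 := (sH.continuous_fderiv (by norm_num)).comp_continuousOn
      ((sx.continuousOn.prodMk sp.continuousOn).prodMk su.continuousOn)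
    have c2 := c1.clm_comp (continuousOn_const (c := ι))
    exact ((InnerProductSpace.toDual ℝ (E n)).symm.continuous.comp_continuousOn c2).neg
  have hfd : ∀ (a q h : E n) (ω : E m), fderiv ℝ (Ham L f) ((a, q), ω) ((h, 0), 0)
      = ⟪q, fderiv ℝ (fun y => f y ω) a h⟫_ℝ + fderiv ℝ (fun y => L y ω) a h := by
    intro a q h ω
    have h1 : HasFDerivAt (Ham L f) (fderiv ℝ (Ham L f) ((a, q), ω)) ((a, q), ω) :=
      (sH.differentiable (by norm_num) _).hasFDerivAt
    have h2 : HasFDerivAt (fun y : E n => (((y, q), ω) : (E n × E n) × E m)) ι a :=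
      HasFDerivAt.comp (g := fun w : E n × E n => (w, ω)) (f := fun y : E n => (y, q)) a
        (hasFDerivAt_prodMk_left (a, q) ω) (hasFDerivAt_prodMk_left a q)
    have h3 := h1.comp a h2
    have hpair : ContDiff ℝ 3 (fun y : E n => (y, ω)) := by fun_prop
    have h4 : HasFDerivAt (fun y => f y ω) (fderiv ℝ (fun y => f y ω) a) a :=
      ((sf.comp hpair).differentiable (by norm_num) a).hasFDerivAt
    have h5 : HasFDerivAt (fun y => L y ω) (fderiv ℝ (fun y => L y ω) a) a :=
      ((hL.comp hpair).differentiable (by norm_num) a).hasFDerivAt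
    have h6 := h5.add ((hasFDerivAt_const q a).inner ℝ h4)
    have h7 := congrArg (fun A : E n →L[ℝ] ℝ => A h) (h3.unique h6)
    have h8 : fderiv ℝ (Ham L f) ((a, q), ω) ((h, 0), 0) =
      (fderiv ℝ (Ham L f) ((a, q), ω) ∘L ι) h := rfl
    rw [h8, h7]
    simp [fderivInnerCLM_apply, add_comm]
  have S : Sys T r L f ψ xx yy pp P uu := by
    refine ⟨hT, hr, hL, sf, hψ, sx, sy, sp, su, cP, ?_, ?_, ?_, ?_, ?_, ?_, ?_⟩
    · intro t ht θ hθ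
      exact hxode _ (hmem θ hθ) t ht
    · intro t ht θ hθ
      exact hxtode _ (hmem θ hθ) t ht
    · intro t ht θ hθ
      apply hasDerivAt_of_inner
      intro w
      refine (hpode _ (hmem θ hθ) t ht w).congr_deriv ?_
      have := hP (t, θ) w
      rw [hfd] at this
      simp only [hxx, hpp, huu] at this ⊢
      linarith
    · intro t ht θ hθ h
      exact hP _ h
    · intro t ht θ hθ c
      exact hstat (xx (t, θ), pp (t, θ)) c
    · intro θ hθ h
      simp only [hxx, hpp]
      rw [hxT _ (hmem θ hθ), hpT _ (hmem θ hθ), gradient, InnerProductSpace.toDual_symm_apply]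
    · intro θ hθ
      simp only [hyy, hxx]
      rw [hxt0 _ (hmem θ hθ)]
      simp
  obtain ⟨x1, sx1, dx⟩ := aux_partial hT 2 xx (by exact_mod_cast sx)
  obtain ⟨x2, sx2, dx1⟩ := aux_partial hT 1 x1 (by exact_mod_cast sx1)
  obtain ⟨p1, sp1, dp⟩ := aux_partial hT 2 pp (by exact_mod_cast sp)
  have m0 : (0 : ℝ) ∈ Icc 0 T := ⟨le_rfl, hT.le⟩
  have z0 : (0 : ℝ) ∈ Ioo (-r) r := ⟨by linarith, hr⟩
  have s0 : ∀ w : ℝ → E n → E n, ContDiffOn ℝ 3 (fun q : ℝ × E n => w q.1 q.2) (Icc 0 T ×ˢ U) →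
      ContDiffOn ℝ 3 (w 0) U := by
    intro w hw
    have h1 : ContDiffOn ℝ 3 (fun z : E n => ((0 : ℝ), z)) U := by
      apply ContDiff.contDiffOn; fun_prop
    exact hw.comp h1 (fun z hz => ⟨m0, hz⟩)
  have hline : ∀ θ : ℝ, HasDerivAt (fun s : ℝ => zbar + s • v) v θ := by
    intro θ
    simpa using ((hasDerivAt_id θ).smul_const v).const_add zbar
  have hw1 : ∀ w : ℝ → E n → E n, ContDiffOn ℝ 3 (fun q : ℝ × E n => w q.1 q.2) (Icc 0 T ×ˢ U) →
      ∀ θ ∈ Ioo (-r) r, HasDerivAt (fun s : ℝ => w 0 (zbar + s • v))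
        (fderiv ℝ (w 0) (zbar + θ • v) v) θ := by
    intro w hw θ hθ
    have h1 : DifferentiableAt ℝ (w 0) (zbar + θ • v) :=
      ((s0 w hw).contDiffAt (hU.mem_nhds (hmem θ hθ))).differentiableAt (by norm_num)
    exact h1.hasFDerivAt.comp_hasDerivAt θ (hline θ)
  have ex1 : ∀ θ ∈ Ioo (-r) r, x1 (0, θ) = fderiv ℝ (x 0) (zbar + θ • v) v :=
    fun θ hθ => (dx 0 m0 θ hθ).unique (hw1 x hxreg θ hθ)
  have ep1 : p1 (0, 0) = fderiv ℝ (p 0) zbar v := by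
    have := (dp 0 m0 0 z0).unique (hw1 p hpreg 0 z0)
    simpa using this
  have hz : x1 (0, 0) = 0 := by
    rw [ex1 0 z0]; simpa using hker
  have ex2 : x2 (0, 0) = iteratedFDeriv ℝ 2 (x 0) zbar ![v, v] := by
    have h1 : DifferentiableAt ℝ (fderiv ℝ (x 0)) (zbar + (0 : ℝ) • v) := by
      rw [zero_smul, add_zero]
      exact (((s0 x hxreg).contDiffAt (hU.mem_nhds hzbar)).fderiv_right (m := 1)
        (by norm_num)).differentiableAt (by norm_num)
    have h2 := (h1.hasFDerivAt.comp_hasDerivAt (0 : ℝ) (hline 0)).clm_apply (hasDerivAt_const (0 : ℝ) v)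
    have h3 := h2.congr_of_eventuallyEq (f₁ := fun s => x1 (0, s)) (by
      filter_upwards [isOpen_Ioo.mem_nhds z0] with θ hθ
      exact ex1 θ hθ)
    have h4 := (dx1 0 m0 0 z0).unique h3
    rw [iteratedFDeriv_two_apply, h4]
    simp
  obtain ⟨r1, r2, r3⟩ := S.third (by exact_mod_cast sx1) (by exact_mod_cast sp1) dx dx1 dp hz
    (fun θ' : ℝ => g (zbar + θ' • v)) (fun θ _ => hg _)
  refine ⟨r1, r2, r3.differentiableAt, ?_⟩
  rw [r3.deriv, ep1, ex2]
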